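/- arXiv:1406.5646 — 2 statements merged into one kernel-verified Lean document; each statement's English description precedes it below -/
import Mathlib

section
/- Let σ > 0, 0 < r < α, B > S_0 > 0, and set m = ln(B/S_0)/σ and μ = (α − σ²/2)/σ. Then B·exp(mμ − m·√(2r + μ²)) > S_0. -/
/-- For `σ > 0`, `0 < r < α`, `B > S₀ > 0`, with `m = ln(B/S₀)/σ` and `μ = (α - σ²/2)/σ`,
the limiting expected discounted payoff `B exp(mμ - m√(2r + μ²))` exceeds `S₀`. -/
theorem barrier_payoff_exceeds_initial_price
    (σ α r S₀ B : ℝ) (hσ : 0 < σ) (hr : 0 < r) (hrα : r < α)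
    (hS₀ : 0 < S₀) (hB : S₀ < B)
    (m μ : ℝ) (hm : m = Real.log (B / S₀) / σ) (hμ : μ = (α - σ ^ 2 / 2) / σ) :
    S₀ < B * Real.exp (m * μ - m * Real.sqrt (2 * r + μ ^ 2)) := by
  have hm_pos : 0 < m := by
    rw [hm]
    exact div_pos (Real.log_pos ((one_lt_div hS₀).2 hB)) hσ
  have hσμ : σ * μ = α - σ ^ 2 / 2 := by
    rw [hμ]
    field_simp
  have h_sum_pos : 0 < σ + μ := by
    refine pos_of_mul_pos_right (a := σ) ?_ hσ.le
    nlinarith [sq_nonneg σ]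
  have h_sqrt : Real.sqrt (2 * r + μ ^ 2) < σ + μ := by
    rw [Real.sqrt_lt' h_sum_pos]
    nlinarith
  have hB_eq : B = S₀ * Real.exp (m * σ) := by
    rw [hm, div_mul_cancel₀ _ hσ.ne', Real.exp_log (div_pos (hS₀.trans hB) hS₀),
      mul_div_cancel₀ _ hS₀.ne']
  rw [hB_eq, mul_assoc, ← Real.exp_add]
  refine lt_mul_of_one_lt_right hS₀ (Real.one_lt_exp_iff.2 ?_)
  nlinarith [mul_lt_mul_of_pos_left h_sqrt hm_pos]
end

section
/- Let σ > 0, 0 < r < α, S_0 > 0, and μ = (α − σ²/2)/σ. The function B ↦ B·(B/S_0)^{(μ − √(2r + μ²))/σ} is strictly increasing on (0, ∞); in particular the limiting expected profit B·(B/S_0)^{(μ − √(2r + μ²))/σ} − S_0 is strictly increasing in the barrier level B. -/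
/-- For `-1 < p` and `0 < c`, the map `x ↦ x (x/c)^p` is strictly increasing on `(0, ∞)`. -/
lemma strictMonoOn_mul_div_rpow {c p : ℝ} (hc : 0 < c) (hp : -1 < p) :
    StrictMonoOn (fun x : ℝ => x * (x / c) ^ p) (Set.Ioi 0) := by
  have key : ∀ x : ℝ, 0 < x → x * (x / c) ^ p = c * (x / c) ^ (1 + p) := by
    intro x hx
    rw [Real.rpow_add (div_pos hx hc), Real.rpow_one]
    field_simp
  intro x hx y hy hxy
  have hx' : 0 < x := hx
  have hy' : 0 < y := hy
  simp only [key x hx', key y hy']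
  have hdiv : x / c < y / c := div_lt_div_of_pos_right hxy hc
  exact mul_lt_mul_of_pos_left
    (Real.rpow_lt_rpow (div_pos hx' hc).le hdiv (by linarith)) hc

/-- For `σ > 0`, `0 < r < α`, `S₀ > 0` and `μ = (α - σ²/2)/σ`, the map
`B ↦ B (B/S₀)^{(μ - √(2r + μ²))/σ}` is strictly increasing on `(0, ∞)`; in particular the
limiting expected profit `B (B/S₀)^{(μ - √(2r + μ²))/σ} - S₀` is strictly increasing in `B`. -/
theorem expected_profit_strictMono_in_barrier
    (σ α r S₀ : ℝ) (hσ : 0 < σ) (hr : 0 < r) (hrα : r < α) (hS₀ : 0 < S₀)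
    (μ : ℝ) (hμ : μ = (α - σ ^ 2 / 2) / σ) :
    StrictMonoOn (fun B : ℝ => B * (B / S₀) ^ ((μ - Real.sqrt (2 * r + μ ^ 2)) / σ))
      (Set.Ioi 0) ∧
    StrictMonoOn
      (fun B : ℝ => B * (B / S₀) ^ ((μ - Real.sqrt (2 * r + μ ^ 2)) / σ) - S₀)
      (Set.Ioi 0) := by
  have hσμ : σ * μ = α - σ ^ 2 / 2 := by
    rw [hμ]
    field_simp
  have hpos : 0 < μ + σ := by
    refine pos_of_mul_pos_right (a := σ) ?_ hσ.le
    nlinarith [sq_nonneg σ]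
  have hsqrt : Real.sqrt (2 * r + μ ^ 2) < μ + σ := by
    rw [Real.sqrt_lt' hpos]
    nlinarith
  have hexp : -1 < (μ - Real.sqrt (2 * r + μ ^ 2)) / σ := by
    rw [lt_div_iff₀ hσ]
    linarith
  have hmono := strictMonoOn_mul_div_rpow hS₀ hexp
  exact ⟨hmono, fun _ hx _ hy hxy => sub_lt_sub_right (hmono hx hy hxy) S₀⟩
end
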